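/- Fix an integer m ≥ 2 and a function t : ℕ → ℕ with t(k) ≥ 1 for all k and t(k) = o(log k) (for every ε > 0 there is k₀ such that t(k) ≤ ε·log k for all k ≥ k₀). Suppose that for every positive integer k, A_k is a deterministic online algorithm for cardinality constrained scheduling on m machines with cardinality bound k which maintains the invariant that after each job of any input sequence the numbers of jobs placed on any two machines differ by at most t(k). Then for every real ρ < m there exist k and an input sequence with at most m·k jobs on which the makespan of A_k's schedule is at least ρ times OPT; that is, the competitive ratio of such a family of balanced algorithms is at least m. -/

import Mathlib

open Finset

/-- The load of machine `i` under schedule `σ` for job sizes `p`. -/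
noncomputable def machineLoad {n m : ℕ} (p : Fin n → ℝ) (σ : Fin n → Fin m) (i : Fin m) : ℝ :=
  ∑ j ∈ Finset.univ.filter (fun j => σ j = i), p j

/-- The makespan of a schedule: the maximum machine load. -/
noncomputable def makespan {n m : ℕ} (p : Fin n → ℝ) (σ : Fin n → Fin m) : ℝ :=
  sSup (Set.range (machineLoad p σ))

/-- A schedule is feasible for cardinality bound `k` if every machine gets at most `k` jobs. -/
def Feasible {n m : ℕ} (k : ℕ) (σ : Fin n → Fin m) : Prop :=
  ∀ i : Fin m, (Finset.univ.filter (fun j => σ j = i)).card ≤ k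

/-- The optimal (minimum) makespan over all feasible schedules on `m` machines with
cardinality bound `k`. -/
noncomputable def OPT (m k : ℕ) {n : ℕ} (p : Fin n → ℝ) : ℝ :=
  sInf ((fun σ : Fin n → Fin m => makespan p σ) '' {σ | Feasible k σ})

/-- The schedule induced by a deterministic online algorithm `A` on input sequence `p`:
job `j` is assigned to the machine `A (p 1, …, p j)`. -/
def onlineSchedule {m : ℕ} (A : List ℝ → Fin m) {n : ℕ} (p : Fin n → ℝ) : Fin n → Fin m :=
  fun j => A ((List.ofFn p).take (j.1 + 1))

/-- An online algorithm is `α`-competitive if on every input sequence of at most `m*k`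
nonnegative jobs the induced schedule is feasible and its makespan is at most `α * OPT`. -/
def Competitive (m k : ℕ) (A : List ℝ → Fin m) (α : ℝ) : Prop :=
  ∀ n : ℕ, n ≤ m * k → ∀ p : Fin n → ℝ, (∀ j, 0 ≤ p j) →
    Feasible k (onlineSchedule A p) ∧
      makespan p (onlineSchedule A p) ≤ α * OPT m k p

/-- The number of jobs among the first `j` jobs of the input that the online algorithm `A`
places on machine `i`. -/
def countUpTo {m : ℕ} (A : List ℝ → Fin m) {n : ℕ} (p : Fin n → ℝ) (j : ℕ) (i : Fin m) : ℕ :=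
  (Finset.univ.filter (fun l : Fin n => l.1 < j ∧ onlineSchedule A p l = i)).card

theorem le_makespan {n m : ℕ} (p : Fin n → ℝ) (σ : Fin n → Fin m) (i : Fin m) :
    machineLoad p σ i ≤ makespan p σ :=
  le_csSup (Set.finite_range _).bddAbove ⟨i, rfl⟩

theorem makespan_nonneg {n m : ℕ} {p : Fin n → ℝ} (hp : ∀ j, 0 ≤ p j) (σ : Fin n → Fin m) :
    0 ≤ makespan p σ := by
  refine Real.sSup_nonneg ?_
  rintro _ ⟨i, rfl⟩
  exact Finset.sum_nonneg fun j _ => hp j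

theorem sum_machineLoad {n m : ℕ} (p : Fin n → ℝ) (σ : Fin n → Fin m) :
    ∑ i, machineLoad p σ i = ∑ j, p j :=
  Finset.sum_fiberwise _ _ _

theorem sum_le_mul_makespan {n m : ℕ} (p : Fin n → ℝ) (σ : Fin n → Fin m) :
    ∑ j, p j ≤ m * makespan p σ := by
  rw [← sum_machineLoad p σ]
  simpa using Finset.sum_le_card_nsmul Finset.univ _ _ fun i _ => le_makespan p σ i

theorem OPT_le_makespan {n m k : ℕ} {p : Fin n → ℝ} (hp : ∀ j, 0 ≤ p j) {σ : Fin n → Fin m}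
    (hσ : Feasible k σ) : OPT m k p ≤ makespan p σ := by
  refine csInf_le ⟨0, ?_⟩ ⟨σ, hσ, rfl⟩
  rintro _ ⟨τ, _, rfl⟩
  exact makespan_nonneg hp τ

/-- Distributing the jobs in sorted order in round-robin fashion fills every machine with exactly
`k` jobs and makes any two loads differ by at most the largest job size. -/
theorem exists_feasible_machineLoad_le_add {m k : ℕ} (hk : 0 < k) {p : Fin (k * m) → ℝ} {M : ℝ}
    (hp : ∀ j, 0 ≤ p j) (hpM : ∀ j, p j ≤ M) :
    ∃ σ : Fin (k * m) → Fin m, Feasible k σ ∧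
      ∀ i i', machineLoad p σ i ≤ machineLoad p σ i' + M := by
  obtain ⟨k, rfl⟩ := Nat.exists_eq_succ_of_ne_zero hk.ne'
  let e : Fin (k + 1) × Fin m ≃ Fin ((k + 1) * m) := finProdFinEquiv.trans (Tuple.sort p)
  let σ : Fin ((k + 1) * m) → Fin m := fun j => (e.symm j).2
  have hload : ∀ (f : Fin ((k + 1) * m) → ℝ) i,
      ∑ j ∈ Finset.univ.filter (fun j => σ j = i), f j = ∑ r, f (e (r, i)) := by
    intro f i
    rw [Finset.sum_filter, ← e.sum_comp, Fintype.sum_prod_type]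
    simp [σ]
  refine ⟨σ, fun i => ?_, fun i i' => ?_⟩
  · have h := hload (fun _ => 1) i
    simp only [Finset.sum_const, Finset.card_univ, Fintype.card_fin, nsmul_eq_mul, mul_one] at h
    exact_mod_cast h.le
  · have hmono : ∀ r : Fin k, p (e (r.castSucc, i)) ≤ p (e (r.succ, i')) := by
      intro r
      refine Tuple.monotone_sort p ?_
      simp only [Fin.le_def, finProdFinEquiv_apply_val, Fin.val_castSucc, Fin.val_succ]
      nlinarith [i.2]
    simp only [machineLoad]
    rw [hload p i, hload p i', Fin.sum_univ_castSucc, Fin.sum_univ_succ]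
    have h := Finset.sum_le_sum fun r (_ : r ∈ Finset.univ) => hmono r
    linarith [hp (e (0, i')), hpM (e (Fin.last k, i))]

theorem mul_OPT_le {m k : ℕ} (hm : 0 < m) (hk : 0 < k) {p : Fin (k * m) → ℝ} {M : ℝ}
    (hp : ∀ j, 0 ≤ p j) (hpM : ∀ j, p j ≤ M) :
    m * OPT m k p ≤ ∑ j, p j + m * M := by
  obtain ⟨σ, hσ, hload⟩ := exists_feasible_machineLoad_le_add hk hp hpM
  have hm' : (0 : ℝ) < m := by exact_mod_cast hm
  have : Nonempty (Fin m) := ⟨⟨0, hm⟩⟩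
  have hle : makespan p σ ≤ (∑ j, p j + m * M) / m := by
    refine csSup_le (Set.range_nonempty _) ?_
    rintro _ ⟨i, rfl⟩
    rw [le_div_iff₀' hm', ← sum_machineLoad p σ]
    have h := Finset.sum_le_sum fun i' (_ : i' ∈ Finset.univ) => hload i i'
    simpa [Finset.sum_add_distrib] using h
  rw [← le_div_iff₀' hm']
  exact (OPT_le_makespan hp hσ).trans hle

theorem OPT_pos {m k : ℕ} (hk : 0 < k) {p : Fin (k * m) → ℝ} (hp : ∀ j, 0 ≤ p j)
    (hsum : 0 < ∑ j, p j) : 0 < OPT m k p := by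
  have hm : 0 < m := by
    rcases Nat.eq_zero_or_pos m with rfl | h
    · simp at hsum
    · exact h
  have hm' : (0 : ℝ) < m := by exact_mod_cast hm
  obtain ⟨σ, hσ, -⟩ := exists_feasible_machineLoad_le_add hk hp
    (M := ∑ j, p j) fun j => Finset.single_le_sum (fun i _ => hp i) (Finset.mem_univ j)
  refine (div_pos hsum hm').trans_le (le_csInf ⟨_, σ, hσ, rfl⟩ ?_)
  rintro _ ⟨τ, _, rfl⟩
  rw [div_le_iff₀' hm']
  exact sum_le_mul_makespan p τ

/-- The adversary against machine `i₀`: the pair of the list of the first `j` jobs and the size of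
the next one. Sizes are multiplied by `q` until `i₀` receives a job, and are then reset to `1`. -/
noncomputable def adversary {m : ℕ} (A : List ℝ → Fin m) (i₀ : Fin m) (q : ℝ) : ℕ → List ℝ × ℝ
  | 0 => ([], 1)
  | j + 1 =>
    let l := (adversary A i₀ q j).1 ++ [(adversary A i₀ q j).2]
    (l, if A l = i₀ then 1 else q * (adversary A i₀ q j).2)

/-- The size of job `j` given by the adversary. -/
noncomputable def adversarySize {m : ℕ} (A : List ℝ → Fin m) (i₀ : Fin m) (q : ℝ) (j : ℕ) : ℝ :=
  (adversary A i₀ q j).2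

/-- The machine to which `A` assigns job `j` of the adversary. -/
noncomputable def adversaryChoice {m : ℕ} (A : List ℝ → Fin m) (i₀ : Fin m) (q : ℝ) (j : ℕ) :
    Fin m :=
  A (adversary A i₀ q (j + 1)).1

section Adversary

variable {m : ℕ} (A : List ℝ → Fin m) (i₀ : Fin m) (q : ℝ)

theorem adversary_fst (j : ℕ) :
    (adversary A i₀ q j).1 = List.ofFn fun i : Fin j => adversarySize A i₀ q i := by
  induction j with
  | zero => simp [adversary]
  | succ j ih =>
    rw [List.ofFn_succ_last]
    simp [adversary, ih, adversarySize]

theorem adversarySize_zero : adversarySize A i₀ q 0 = 1 := rfl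

theorem adversarySize_succ (j : ℕ) :
    adversarySize A i₀ q (j + 1) =
      if adversaryChoice A i₀ q j = i₀ then 1 else q * adversarySize A i₀ q j := rfl

theorem onlineSchedule_adversarySize {n : ℕ} (j : Fin n) :
    onlineSchedule A (fun i : Fin n => adversarySize A i₀ q i) j = adversaryChoice A i₀ q j := by
  unfold onlineSchedule adversaryChoice
  rw [adversary_fst]
  congr 1
  refine List.ext_getElem (by simp) fun i _ _ => by simp [-List.ofFn_succ]

theorem countUpTo_adversarySize {n j : ℕ} (hj : j ≤ n) (i : Fin m) :
    countUpTo A (fun l : Fin n => adversarySize A i₀ q l) j i =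
      ((Finset.range j).filter fun l => adversaryChoice A i₀ q l = i).card := by
  unfold countUpTo
  simp only [onlineSchedule_adversarySize]
  refine Finset.card_bij (fun l _ => l.1) ?_ ?_ ?_
  · intro l hl
    simpa using hl
  · intro a _ b _ h
    exact Fin.ext h
  · intro l hl
    simp only [Finset.mem_filter, Finset.mem_range] at hl
    exact ⟨⟨l, hl.1.trans_le hj⟩, by simpa using hl, rfl⟩

theorem one_le_adversarySize (hq : 1 ≤ q) (j : ℕ) : 1 ≤ adversarySize A i₀ q j := by
  induction j with
  | zero => exact le_rfl
  | succ j ih =>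
    rw [adversarySize_succ]
    split_ifs
    · exact le_rfl
    · nlinarith

/-- The volume placed on machines other than `i₀` is small compared to the volume on `i₀`. -/
theorem mul_sum_adversarySize_le (hq : 1 ≤ q) (j : ℕ) :
    (q - 1) * ∑ l ∈ Finset.range j, adversarySize A i₀ q l ≤
      q * ∑ l ∈ (Finset.range j).filter (fun l => adversaryChoice A i₀ q l = i₀),
        adversarySize A i₀ q l + adversarySize A i₀ q j := by
  induction j with
  | zero => simp [adversarySize_zero]
  | succ j ih =>
    rw [Finset.sum_range_succ, Finset.sum_filter, Finset.sum_range_succ, ← Finset.sum_filter,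
      adversarySize_succ]
    have := one_le_adversarySize A i₀ q hq j
    split_ifs <;> nlinarith

theorem exists_adversarySize_eq_pow (j : ℕ) :
    ∃ a ≤ j, adversarySize A i₀ q j = q ^ (j - a) ∧
      ∀ l, a ≤ l → l < j → adversaryChoice A i₀ q l ≠ i₀ := by
  induction j with
  | zero => exact ⟨0, le_rfl, by simp [adversarySize_zero], by omega⟩
  | succ j ih =>
    by_cases h : adversaryChoice A i₀ q j = i₀
    · exact ⟨j + 1, le_rfl, by simp [adversarySize_succ, h], by omega⟩
    · obtain ⟨a, haj, hs, hne⟩ := ih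
      refine ⟨a, by omega, ?_, fun l hal hl => ?_⟩
      · rw [adversarySize_succ, if_neg h, hs, Nat.succ_sub haj, pow_succ']
      · rcases Nat.lt_succ_iff_lt_or_eq.mp hl with hl | rfl
        · exact hne l hal hl
        · exact h

theorem adversarySize_le_pow (hq : 1 ≤ q) {n t : ℕ}
    (hbal : ∀ j ≤ n, ∀ i₁ i₂ : Fin m,
      (countUpTo A (fun l : Fin n => adversarySize A i₀ q l) j i₁ : ℤ) -
        (countUpTo A (fun l : Fin n => adversarySize A i₀ q l) j i₂ : ℤ) ≤ (t : ℤ))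
    {j : ℕ} (hj : j ≤ n) : adversarySize A i₀ q j ≤ q ^ (m * (2 * t)) := by
  obtain ⟨a, haj, hs, hne⟩ := exists_adversarySize_eq_pow A i₀ q j
  rw [hs]
  refine pow_le_pow_right₀ hq ?_
  let c : ℕ → Fin m → ℕ := fun j i =>
    ((Finset.range j).filter fun l => adversaryChoice A i₀ q l = i).card
  have hc : ∀ j ≤ n, ∀ i₁ i₂, c j i₁ ≤ c j i₂ + t := by
    intro j hj i₁ i₂
    have h := hbal j hj i₁ i₂
    rw [countUpTo_adversarySize A i₀ q hj, countUpTo_adversarySize A i₀ q hj] at h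
    simp only [c]
    omega
  have hsum : ∀ j, ∑ i, c j i = j := by
    intro j
    simpa [c] using (Finset.card_eq_sum_card_fiberwise (s := Finset.range j) (t := Finset.univ)
      (f := adversaryChoice A i₀ q) fun _ _ => by simp).symm
  have hi₀ : c j i₀ = c a i₀ := by
    simp only [c]
    congr 1
    ext l
    simp only [Finset.mem_filter, Finset.mem_range]
    refine ⟨fun ⟨hl, h⟩ => ⟨?_, h⟩, fun ⟨hl, h⟩ => ⟨hl.trans_le haj, h⟩⟩
    by_contra hal
    exact hne l (not_lt.mp hal) hl h
  have hle : ∑ i, c j i ≤ ∑ i, (c a i + 2 * t) :=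
    Finset.sum_le_sum fun i _ => by
      have h₁ := hc j hj i i₀
      have h₂ := hc a (haj.trans hj) i₀ i
      omega
  rw [Finset.sum_add_distrib, hsum, hsum] at hle
  simp at hle
  omega

end Adversary

theorem exists_mul_pow_le_of_isLittleO_log {t : ℕ → ℕ}
    (hto : ∀ ε : ℝ, 0 < ε → ∃ k₀ : ℕ, ∀ k : ℕ, k₀ ≤ k → (t k : ℝ) ≤ ε * Real.log k)
    {q : ℝ} (hq : 1 < q) {b : ℕ} (hb : 0 < b) (C : ℝ) :
    ∃ k : ℕ, 0 < k ∧ C * q ^ (b * t k) ≤ k := by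
  have hlog : 0 < Real.log q := Real.log_pos hq
  have hb' : (0 : ℝ) < b := by exact_mod_cast hb
  obtain ⟨k₀, hk₀⟩ := hto (1 / (2 * b * Real.log q)) (by positivity)
  let k := max (max k₀ 1) ⌈C ^ 2⌉₊
  have hk1 : 1 ≤ k := (le_max_right _ _).trans (le_max_left _ _)
  have hk0 : (0 : ℝ) < k := by exact_mod_cast hk1
  have hC : C ^ 2 ≤ k := (Nat.le_ceil _).trans (by exact_mod_cast le_max_right _ _)
  refine ⟨k, hk1, ?_⟩
  have ht := hk₀ k ((le_max_left _ _).trans (le_max_left _ _))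
  have hpow : q ^ (b * t k) ≤ √k := by
    rw [← Real.log_le_log_iff (by positivity) (by positivity), Real.log_pow,
      Real.log_sqrt hk0.le]
    push_cast
    calc (b : ℝ) * t k * Real.log q
        ≤ b * (1 / (2 * b * Real.log q) * Real.log k) * Real.log q := by gcongr
      _ = Real.log k / 2 := by field_simp
  calc C * q ^ (b * t k) ≤ √k * √k :=
        mul_le_mul (Real.le_sqrt_of_sq_le hC) hpow (by positivity) (by positivity)
    _ = k := Real.mul_self_sqrt hk0.le

/-- The lower bound on balanced algorithms, witnessed by an input whose optimum is positive. -/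
theorem exists_OPT_pos_and_mul_OPT_le_makespan
    {m : ℕ} (hm : 0 < m) {t : ℕ → ℕ}
    (hto : ∀ ε : ℝ, 0 < ε → ∃ k₀ : ℕ, ∀ k : ℕ, k₀ ≤ k → (t k : ℝ) ≤ ε * Real.log k)
    {A : ℕ → List ℝ → Fin m}
    (hbal : ∀ k : ℕ, 0 < k → ∀ n : ℕ, n ≤ m * k → ∀ p : Fin n → ℝ, (∀ j, 0 ≤ p j) →
      ∀ j : ℕ, j ≤ n → ∀ i₁ i₂ : Fin m,
        (countUpTo (A k) p j i₁ : ℤ) - (countUpTo (A k) p j i₂ : ℤ) ≤ (t k : ℤ))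
    {ρ : ℝ} (hρ0 : 0 ≤ ρ) (hρ : ρ < m) :
    ∃ k : ℕ, 0 < k ∧ ∃ p : Fin (k * m) → ℝ, (∀ j, 0 ≤ p j) ∧ 0 < OPT m k p ∧
      ρ * OPT m k p ≤ makespan p (onlineSchedule (A k) p) := by
  have hm' : (0 : ℝ) < m := by exact_mod_cast hm
  have hgap : 0 < m - ρ := sub_pos.mpr hρ
  let q : ℝ := max 2 ((m + 1) / (m - ρ))
  have hq2 : 2 ≤ q := le_max_left _ _
  have hq : m + 1 ≤ q * (m - ρ) := (div_le_iff₀ hgap).mp (le_max_right _ _)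
  obtain ⟨k, hk, hkM⟩ := exists_mul_pow_le_of_isLittleO_log hto (by linarith : 1 < q)
    (by positivity : 0 < m * 2) (1 + ρ * q)
  let i₀ : Fin m := ⟨0, hm⟩
  let s := adversarySize (A k) i₀ q
  let p : Fin (k * m) → ℝ := fun j => s j
  let M : ℝ := q ^ (m * (2 * t k))
  have hs1 : ∀ j, 1 ≤ s j := one_le_adversarySize (A k) i₀ q (by linarith)
  have hp : ∀ j, 0 ≤ p j := fun j => zero_le_one.trans (hs1 j)
  have hsM : ∀ j ≤ k * m, s j ≤ M := fun j hj =>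
    adversarySize_le_pow (A k) i₀ q (by linarith)
      (hbal k hk (k * m) (mul_comm k m).le p hp) hj
  have hT : (k * m : ℝ) ≤ ∑ j, p j := by
    simpa using Finset.card_nsmul_le_sum Finset.univ p 1 fun j _ => hs1 j
  have hT0 : 0 < ∑ j, p j := lt_of_lt_of_le (by positivity) hT
  refine ⟨k, hk, p, hp, OPT_pos hk hp hT0, ?_⟩
  have hopt := mul_OPT_le hm hk hp fun j => hsM j j.2.le
  have hload : machineLoad p (onlineSchedule (A k) p) i₀ =
      ∑ l ∈ (Finset.range (k * m)).filter (fun l => adversaryChoice (A k) i₀ q l = i₀), s l := by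
    simp only [machineLoad, p, s, onlineSchedule_adversarySize]
    rw [Finset.sum_filter, Finset.sum_filter, Finset.sum_range]
  have hwaste := mul_sum_adversarySize_le (A k) i₀ q (by linarith) (k * m)
  rw [Finset.sum_range] at hwaste
  have hG := le_makespan p (onlineSchedule (A k) p) i₀
  rw [hload] at hG
  refine le_trans ?_ hG
  have hlast := hsM (k * m) le_rfl
  have hkM' : (1 + ρ * q) * M ≤ k := by simpa [M, mul_assoc] using hkM
  set T := ∑ j, p j with hTdef
  set G := ∑ l ∈ (Finset.range (k * m)).filter (fun l => adversaryChoice (A k) i₀ q l = i₀), s l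
  have hGlow : (q - 1) * T ≤ q * G + M := hwaste.trans (by gcongr)
  have hTgap : T ≤ (q * (m - ρ) - m) * T := by nlinarith
  have hMT : m * ((1 + ρ * q) * M) ≤ T := by nlinarith
  have hqm : 0 < q * m := by positivity
  refine le_of_mul_le_mul_left ?_ hqm
  have h₁ : q * ρ * (m * OPT m k p) ≤ q * ρ * (T + m * M) := by gcongr
  have h₂ : m * ((q - 1) * T) ≤ m * (q * G + M) := by gcongr
  linarith

/-- Fix `m ≥ 2` and `t : ℕ → ℕ` with `t k ≥ 1` and `t k = o(log k)`.  If `A k` is, for every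
positive `k`, a deterministic online algorithm on `m` machines with cardinality bound `k`
maintaining the invariant that after each job the numbers of jobs placed on any two machines
differ by at most `t k`, then for every `ρ < m` there are `k` and an input sequence of at most
`m*k` jobs on which the makespan of the schedule of `A k` is at least `ρ * OPT`. -/
theorem balanced_algorithms_lower_bound_m
    (m : ℕ) (hm : 2 ≤ m)
    (t : ℕ → ℕ) (ht1 : ∀ k, 1 ≤ t k)
    (hto : ∀ ε : ℝ, 0 < ε → ∃ k₀ : ℕ, ∀ k : ℕ, k₀ ≤ k → (t k : ℝ) ≤ ε * Real.log k)
    (A : ℕ → List ℝ → Fin m)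
    (hbal : ∀ k : ℕ, 0 < k → ∀ n : ℕ, n ≤ m * k → ∀ p : Fin n → ℝ, (∀ j, 0 ≤ p j) →
      ∀ j : ℕ, j ≤ n → ∀ i₁ i₂ : Fin m,
        (countUpTo (A k) p j i₁ : ℤ) - (countUpTo (A k) p j i₂ : ℤ) ≤ (t k : ℤ)) :
    ∀ ρ : ℝ, ρ < m →
      ∃ k : ℕ, 0 < k ∧
        ∃ n : ℕ, n ≤ m * k ∧
          ∃ p : Fin n → ℝ, (∀ j, 0 ≤ p j) ∧
            ρ * OPT m k p ≤ makespan p (onlineSchedule (A k) p) := by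
  intro ρ hρ
  have hm' : 0 < m := by omega
  obtain ⟨k, hk, p, hp, hpos, hle⟩ := exists_OPT_pos_and_mul_OPT_le_makespan hm' hto hbal
    (le_max_right ρ 0) (max_lt hρ (by exact_mod_cast hm'))
  exact ⟨k, hk, k * m, (mul_comm k m).le, p, hp,
    (mul_le_mul_of_nonneg_right (le_max_left ρ 0) hpos.le).trans hle⟩
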